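/- Let X be a Tychonoff (completely regular Hausdorff) space and let H be a non-vanishing closed ideal of C_B(X). The following are equivalent: (1) every connected component of λ_H X is open in λ_H X (in particular λ_H X is locally connected); (2) there is a family (H_i)_{i∈I} of indecomposable closed ideals of C_B(X) such that for each i ∈ I the intersection of H_i with the ideal generated by ⋃_{j∈I, j≠i} H_j is {0}, and H equals the norm-closure of the ideal generated by ⋃_{i∈I} H_i. -/

import Mathlib

open Set Filter Topology BoundedContinuousFunction

noncomputable section

universe u

/-- The subspace `λ_H X = ⋃_{h ∈ H} cl_{βX} {x : |h x| > 1}` of `βX`. -/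
def lambdaH {X : Type*} [TopologicalSpace X] (H : Set (X →ᵇ ℂ)) : Set (StoneCech X) :=
  ⋃ h ∈ H, closure (stoneCechUnit '' {x : X | 1 < ‖h x‖})

/-- An ideal of `C_B(X)` is indecomposable if it is not the direct sum of two
nonzero ideals of `C_B(X)`. -/
def Indecomposable' {X : Type*} [TopologicalSpace X] (H : Ideal (X →ᵇ ℂ)) : Prop :=
  ¬ ∃ I J : Ideal (X →ᵇ ℂ), I ≠ ⊥ ∧ J ≠ ⊥ ∧ I ⊓ J = ⊥ ∧ H = I + J

/-- The components of an open set `U` are open in `U` exactly when `U` is a disjoint union of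
preconnected open sets. -/
theorem IsOpen.isOpen_connectedComponent_iff_exists_partition {Y : Type u} [TopologicalSpace Y]
    {U : Set Y} (hU : IsOpen U) :
    (∀ y : U, IsOpen (connectedComponent y)) ↔
      ∃ (ι : Type u) (V : ι → Set Y), (∀ i, IsOpen (V i) ∧ IsPreconnected (V i)) ∧
        Pairwise (Function.onFun Disjoint V) ∧ U = ⋃ i, V i := by
  constructor
  · intro h
    refine ⟨ConnectedComponents U, fun c => Subtype.val '' (ConnectedComponents.mk ⁻¹' {c}),
      fun c => ?_, fun c d hcd => ?_, ?_⟩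
    · obtain ⟨y, rfl⟩ := ConnectedComponents.surjective_coe c
      simp only [connectedComponents_preimage_singleton]
      exact ⟨hU.isOpenMap_subtype_val _ (h y),
        isPreconnected_connectedComponent.image _ continuous_subtype_val.continuousOn⟩
    · exact (disjoint_image_iff Subtype.val_injective).2
        (Disjoint.preimage _ (disjoint_singleton.2 hcd))
    · rw [← image_iUnion, ← preimage_iUnion, iUnion_of_singleton, preimage_univ, image_univ,
        Subtype.range_val]
  · rintro ⟨ι, V, hV, hdisj, rfl⟩ y
    obtain ⟨i, hi⟩ := mem_iUnion.1 y.2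
    have hopen : ∀ j, IsOpen (Subtype.val ⁻¹' V j : Set ↥(⋃ i, V i)) := fun j =>
      (hV j).1.preimage continuous_subtype_val
    have hcompl : (Subtype.val ⁻¹' V i : Set ↥(⋃ i, V i))ᶜ =
        ⋃ j ∈ {j | j ≠ i}, Subtype.val ⁻¹' V j := by
      ext z
      simp only [mem_compl_iff, mem_preimage, mem_iUnion, mem_ofPred_eq, exists_prop]
      constructor
      · intro hz
        obtain ⟨j, hj⟩ := mem_iUnion.1 z.2
        exact ⟨j, fun hji => hz (hji ▸ hj), hj⟩
      · rintro ⟨j, hji, hj⟩ hz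
        exact disjoint_left.1 (hdisj hji) hj hz
    have hclopen : IsClopen (Subtype.val ⁻¹' V i : Set ↥(⋃ i, V i)) := by
      refine ⟨isOpen_compl_iff.1 ?_, hopen i⟩
      rw [hcompl]
      exact isOpen_biUnion fun j _ => hopen j
    have hconn : IsPreconnected (Subtype.val ⁻¹' V i : Set ↥(⋃ i, V i)) := by
      rw [← IsInducing.subtypeVal.isPreconnected_image, Subtype.image_preimage_coe,
        inter_eq_right.2 (subset_iUnion V i)]
      exact (hV i).2
    rw [subset_antisymm (hclopen.connectedComponent_subset hi)
      (hconn.subset_connectedComponent hi)]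
    exact hopen i

namespace Ideal

variable {A B : Type*} [CommRing A] [CommRing B]

/-- An ideal is indecomposable if it is not the direct sum of two nonzero ideals. -/
def IsIndecomposable (H : Ideal A) : Prop :=
  ¬ ∃ I J : Ideal A, I ≠ ⊥ ∧ J ≠ ⊥ ∧ I ⊓ J = ⊥ ∧ H = I + J

/-- `H` is the closure of the direct sum of a family of indecomposable closed ideals. -/
def HasIndecomposableDecomposition [TopologicalSpace A] (H : Ideal A) : Prop :=
  ∃ (ι : Type u) (Hi : ι → Ideal A),
    (∀ i, IsClosed (Hi i : Set A) ∧ (Hi i).IsIndecomposable) ∧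
    (∀ i : ι, Hi i ⊓ (⨆ j ∈ {j : ι | j ≠ i}, Hi j) = ⊥) ∧
    (H : Set A) = closure ((⨆ i, Hi i : Ideal A) : Set A)

theorem coe_idealComapOrderIso (e : A ≃+* B) (I : Ideal B) :
    (e.idealComapOrderIso I : Set A) = e ⁻¹' I := rfl

theorem IsIndecomposable.idealComapOrderIso {H : Ideal B} (hH : H.IsIndecomposable)
    (e : A ≃+* B) : (e.idealComapOrderIso H).IsIndecomposable := by
  rintro ⟨I, J, hI, hJ, hIJ, h⟩
  refine hH ⟨e.idealComapOrderIso.symm I, e.idealComapOrderIso.symm J, ?_, ?_, ?_, ?_⟩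
  · rwa [Ne, _root_.map_eq_bot_iff]
  · rwa [Ne, _root_.map_eq_bot_iff]
  · rw [← OrderIso.map_inf, hIJ, OrderIso.map_bot]
  · rw [Submodule.add_eq_sup, ← OrderIso.map_sup, ← Submodule.add_eq_sup, ← h, OrderIso.symm_apply_apply]

theorem HasIndecomposableDecomposition.idealComapOrderIso [TopologicalSpace A]
    [TopologicalSpace B] {H : Ideal B} (hH : HasIndecomposableDecomposition.{u} H)
    (e : A ≃+* B) (he : IsHomeomorph e) :
    HasIndecomposableDecomposition.{u} (e.idealComapOrderIso H) := by
  obtain ⟨ι, Hi, h₁, h₂, h₃⟩ := hH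
  refine ⟨ι, fun i => e.idealComapOrderIso (Hi i), fun i => ⟨?_, ?_⟩, fun i => ?_, ?_⟩
  · rw [coe_idealComapOrderIso]
    exact (h₁ i).1.preimage he.continuous
  · exact (h₁ i).2.idealComapOrderIso e
  · simp only [← OrderIso.map_iSup, ← OrderIso.map_inf, h₂, OrderIso.map_bot]
  · rw [← OrderIso.map_iSup, coe_idealComapOrderIso, coe_idealComapOrderIso, h₃]
    exact he.isOpenMap.preimage_closure_eq_closure_preimage he.continuous _

end Ideal

namespace ContinuousMap

variable {K : Type u} [TopologicalSpace K]

theorem inf_eq_bot_iff_disjoint_setOfIdeal {I J : Ideal C(K, ℂ)} :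
    I ⊓ J = ⊥ ↔ Disjoint (setOfIdeal I) (setOfIdeal J) := by
  constructor
  · intro h
    rw [disjoint_left]
    intro x hxI hxJ
    obtain ⟨f, hf, hfx⟩ := mem_setOfIdeal.1 hxI
    obtain ⟨g, hg, hgx⟩ := mem_setOfIdeal.1 hxJ
    have hfg : f * g ∈ I ⊓ J := ⟨I.mul_mem_right _ hf, J.mul_mem_left _ hg⟩
    rw [h, Ideal.mem_bot] at hfg
    exact mul_ne_zero hfx hgx (DFunLike.congr_fun hfg x)
  · intro h
    rw [eq_bot_iff]
    rintro f ⟨hfI, hfJ⟩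
    rw [Ideal.mem_bot]
    ext x
    by_contra hx
    exact disjoint_left.1 h (mem_setOfIdeal.2 ⟨f, hfI, hx⟩) (mem_setOfIdeal.2 ⟨f, hfJ, hx⟩)

theorem setOfIdeal_nonempty_iff {I : Ideal C(K, ℂ)} : (setOfIdeal I).Nonempty ↔ I ≠ ⊥ := by
  rw [nonempty_iff_ne_empty, not_iff_not, ← subset_empty_iff, ← le_bot_iff, ← idealOfEmpty_eq_bot]
  exact ideal_gc K ℂ I ∅

/-- The restriction of a function to one part of an open partition of a set off which it vanishes,
extended by zero. -/
theorem exists_eqOn_of_disjoint {f : C(K, ℂ)} {V W : Set K} (hV : IsOpen V) (hW : IsOpen W)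
    (hVW : Disjoint V W) (hf : ∀ x ∉ V ∪ W, f x = 0) :
    ∃ g : C(K, ℂ), EqOn g f V ∧ ∀ x ∉ V, g x = 0 := by
  classical
  refine ⟨⟨V.indicator f, continuous_iff_continuousAt.2 fun x => ?_⟩,
    fun x hx => indicator_of_mem hx _, fun x hx => indicator_of_notMem hx _⟩
  by_cases hxV : x ∈ V
  · refine f.continuous.continuousAt.congr ?_
    filter_upwards [hV.mem_nhds hxV] with z hz
    rw [indicator_of_mem hz]
  · by_cases hxW : x ∈ W
    · refine (continuousAt_const (y := (0 : ℂ))).congr ?_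
      filter_upwards [hW.mem_nhds hxW] with z hz
      rw [indicator_of_notMem (disjoint_right.1 hVW hz)]
    · have hfx : f x = 0 := hf x (by simp [hxV, hxW])
      have h0 : V.indicator f x = 0 := indicator_of_notMem hxV _
      have ht : Tendsto (fun z => ‖f z‖) (𝓝 x) (𝓝 0) := by
        simpa [hfx] using (f.continuous.tendsto x).norm
      rw [ContinuousAt, h0]
      exact squeeze_zero_norm (fun z => norm_indicator_le_norm_self _ _) ht

theorem setOfIdeal_iSup {ι : Sort*} (I : ι → Ideal C(K, ℂ)) :
    setOfIdeal (⨆ i, I i) = ⋃ i, setOfIdeal (I i) :=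
  (ideal_gc K ℂ).l_iSup

theorem setOfIdeal_sup (I J : Ideal C(K, ℂ)) :
    setOfIdeal (I ⊔ J) = setOfIdeal I ∪ setOfIdeal J :=
  (ideal_gc K ℂ).l_sup

variable [CompactSpace K] [T2Space K]

theorem setOfIdeal_closure (I : Ideal C(K, ℂ)) : setOfIdeal I.closure = setOfIdeal I := by
  rw [← idealOfSet_ofIdeal_eq_closure, setOfIdeal_ofSet_of_isOpen ℂ (setOfIdeal_open I)]

theorem isIndecomposable_idealOfSet {V : Set K} (hV : IsOpen V) (hc : IsPreconnected V) :
    (idealOfSet ℂ V).IsIndecomposable := by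
  rintro ⟨I, J, hI, hJ, hIJ, h⟩
  have hunion : V = setOfIdeal I ∪ setOfIdeal J := by
    rw [← setOfIdeal_sup, ← Submodule.add_eq_sup, ← h, setOfIdeal_ofSet_of_isOpen ℂ hV]
  rw [← setOfIdeal_nonempty_iff] at hI hJ
  obtain ⟨x, -, hxI, hxJ⟩ := hc _ _ (setOfIdeal_open I) (setOfIdeal_open J) hunion.subset
    (by rwa [hunion, union_inter_cancel_left]) (by rwa [hunion, union_inter_cancel_right])
  exact disjoint_left.1 (inf_eq_bot_iff_disjoint_setOfIdeal.1 hIJ) hxI hxJ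

theorem isPreconnected_setOfIdeal {H : Ideal C(K, ℂ)} (hH : IsClosed (H : Set C(K, ℂ)))
    (hi : H.IsIndecomposable) : IsPreconnected (setOfIdeal H) := by
  intro u v hu hv huv hnu hnv
  by_contra hne
  have hopen := setOfIdeal_open H
  have hu' := hopen.inter hu
  have hv' := hopen.inter hv
  have hdisj : Disjoint (setOfIdeal H ∩ u) (setOfIdeal H ∩ v) :=
    disjoint_left.2 fun x hxu hxv => hne ⟨x, hxu.1, hxu.2, hxv.2⟩
  refine hi ⟨idealOfSet ℂ (setOfIdeal H ∩ u), idealOfSet ℂ (setOfIdeal H ∩ v), ?_, ?_, ?_, ?_⟩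
  · rwa [← setOfIdeal_nonempty_iff, setOfIdeal_ofSet_of_isOpen ℂ hu']
  · rwa [← setOfIdeal_nonempty_iff, setOfIdeal_ofSet_of_isOpen ℂ hv']
  · rwa [inf_eq_bot_iff_disjoint_setOfIdeal, setOfIdeal_ofSet_of_isOpen ℂ hu',
      setOfIdeal_ofSet_of_isOpen ℂ hv']
  · rw [Submodule.add_eq_sup]
    refine le_antisymm (fun f hf => ?_) (sup_le ?_ ?_)
    · have hcover : setOfIdeal H = setOfIdeal H ∩ u ∪ setOfIdeal H ∩ v := by
        rw [← inter_union_distrib_left, inter_eq_left.2 huv]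
      have hf0 : ∀ x ∉ setOfIdeal H ∩ u ∪ setOfIdeal H ∩ v, f x = 0 := fun x hx =>
        notMem_setOfIdeal.1 (hcover ▸ hx) hf
      obtain ⟨g, hgu, hg0⟩ := exists_eqOn_of_disjoint hu' hv' hdisj hf0
      have hfg : f - g ∈ idealOfSet ℂ (setOfIdeal H ∩ v) := by
        intro x hx
        by_cases hxu : x ∈ setOfIdeal H ∩ u
        · simp [hgu hxu]
        · simp [hg0 x hxu, hf0 x (by rintro (h | h); exacts [hxu h, hx h])]
      rw [← add_sub_cancel g f]
      exact add_mem (Ideal.mem_sup_left hg0) (Ideal.mem_sup_right hfg)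
    all_goals
      conv_rhs => rw [← idealOfSet_ofIdeal_isClosed hH]
      exact (ideal_gc K ℂ).monotone_u inter_subset_left

theorem hasIndecomposableDecomposition_iff {H : Ideal C(K, ℂ)}
    (hH : IsClosed (H : Set C(K, ℂ))) :
    Ideal.HasIndecomposableDecomposition.{u} H ↔
      ∃ (ι : Type u) (V : ι → Set K), (∀ i, IsOpen (V i) ∧ IsPreconnected (V i)) ∧
        Pairwise (Function.onFun Disjoint V) ∧ setOfIdeal H = ⋃ i, V i := by
  constructor
  · rintro ⟨ι, Hi, h₁, h₂, h₃⟩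
    refine ⟨ι, fun i => setOfIdeal (Hi i), fun i => ⟨setOfIdeal_open _,
      isPreconnected_setOfIdeal (h₁ i).1 (h₁ i).2⟩, fun i j hij => ?_, ?_⟩
    · refine inf_eq_bot_iff_disjoint_setOfIdeal.1 (eq_bot_iff.2 ?_)
      rw [← h₂ i]
      exact inf_le_inf_left _ (le_iSup₂_of_le j hij.symm le_rfl)
    · have h : H = (⨆ i, Hi i).closure := SetLike.coe_injective h₃
      rw [h, setOfIdeal_closure, setOfIdeal_iSup]
  · rintro ⟨ι, V, hV, hdisj, hU⟩
    have hset : ∀ i, setOfIdeal (idealOfSet ℂ (V i)) = V i := fun i =>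
      setOfIdeal_ofSet_of_isOpen ℂ (hV i).1
    refine ⟨ι, fun i => idealOfSet ℂ (V i), fun i => ⟨idealOfSet_closed ℂ _,
      isIndecomposable_idealOfSet (hV i).1 (hV i).2⟩, fun i => ?_, ?_⟩
    · simp only [inf_eq_bot_iff_disjoint_setOfIdeal, setOfIdeal_iSup, hset, disjoint_iUnion_right]
      exact fun j hj => hdisj (Ne.symm hj)
    · rw [← Ideal.coe_closure, ← idealOfSet_ofIdeal_eq_closure, setOfIdeal_iSup]
      simp only [hset]
      rw [← hU, idealOfSet_ofIdeal_isClosed hH]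

end ContinuousMap

namespace StoneCech

variable {X : Type u} [TopologicalSpace X]

/-- Restriction of continuous functions on the Stone–Čech compactification to the space. -/
def restrict : C(StoneCech X, ℂ) →+* (X →ᵇ ℂ) where
  toFun f := (BoundedContinuousFunction.mkOfCompact f).compContinuous
    ⟨stoneCechUnit, continuous_stoneCechUnit⟩
  map_one' := rfl
  map_mul' _ _ := rfl
  map_zero' := rfl
  map_add' _ _ := rfl

@[simp]
theorem restrict_apply (f : C(StoneCech X, ℂ)) (x : X) : restrict f x = f (stoneCechUnit x) := rfl

theorem isometry_restrict : Isometry (restrict (X := X)) := by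
  refine AddMonoidHomClass.isometry_of_norm _ fun f => le_antisymm ?_ ?_
  · exact (BoundedContinuousFunction.norm_le (norm_nonneg f)).2 fun x => f.norm_coe_le_norm _
  · refine (ContinuousMap.norm_le _ (norm_nonneg _)).2 fun y => ?_
    refine denseRange_stoneCechUnit.induction_on y
      (isClosed_le f.continuous.norm continuous_const) fun x => ?_
    exact (restrict f).norm_coe_le_norm x

theorem restrict_surjective : Function.Surjective (restrict (X := X)) := by
  intro f
  let g : X → Metric.closedBall (0 : ℂ) ‖f‖ := fun x =>
    ⟨f x, mem_closedBall_zero_iff.2 (f.norm_coe_le_norm x)⟩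
  have hg : Continuous g := f.continuous.subtype_mk _
  have : CompactSpace (Metric.closedBall (0 : ℂ) ‖f‖) :=
    isCompact_iff_compactSpace.1 (isCompact_closedBall 0 ‖f‖)
  refine ⟨⟨fun y => (stoneCechExtend hg y).1,
    continuous_subtype_val.comp (continuous_stoneCechExtend hg)⟩, ?_⟩
  ext x
  simp [g, stoneCechExtend_stoneCechUnit]

/-- Restriction identifies continuous functions on the Stone–Čech compactification with bounded
continuous functions on the space. -/
def restrictEquiv : C(StoneCech X, ℂ) ≃+* (X →ᵇ ℂ) :=
  RingEquiv.ofBijective restrict ⟨isometry_restrict.injective, restrict_surjective⟩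

theorem isHomeomorph_restrictEquiv : IsHomeomorph (restrictEquiv (X := X)) :=
  (IsometryEquiv.mk restrictEquiv.toEquiv isometry_restrict).toHomeomorph.isHomeomorph

theorem isHomeomorph_restrictEquiv_symm : IsHomeomorph (restrictEquiv (X := X)).symm :=
  (IsometryEquiv.mk restrictEquiv.toEquiv isometry_restrict).toHomeomorph.symm.isHomeomorph

theorem lambdaH_eq_setOfIdeal (H : Ideal (X →ᵇ ℂ)) :
    lambdaH (H : Set (X →ᵇ ℂ)) =
      ContinuousMap.setOfIdeal (restrictEquiv.idealComapOrderIso H) := by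
  ext y
  simp only [lambdaH, mem_iUnion, exists_prop, ContinuousMap.mem_setOfIdeal, SetLike.mem_coe]
  constructor
  · rintro ⟨h, hH, hy⟩
    obtain ⟨f, rfl⟩ := restrictEquiv.surjective h
    refine ⟨f, hH, fun h0 => ?_⟩
    have hle : closure (stoneCechUnit '' {x : X | 1 < ‖restrictEquiv f x‖}) ⊆
        {z | 1 ≤ ‖f z‖} := by
      refine closure_minimal ?_ (isClosed_le continuous_const f.continuous.norm)
      rintro _ ⟨x, hx, rfl⟩
      exact (mem_ofPred.1 hx).le
    have h1 : 1 ≤ ‖f y‖ := hle hy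
    rw [h0, norm_zero] at h1
    exact absurd h1 (by norm_num)
  · rintro ⟨f, hf, hfy⟩
    set g : C(StoneCech X, ℂ) := ContinuousMap.const _ (2 / f y) * f
    have hg : 1 < ‖g y‖ := by simp [g, div_mul_cancel₀ _ hfy]
    refine ⟨restrictEquiv g, Ideal.mul_mem_left (restrictEquiv.idealComapOrderIso H) _ hf, ?_⟩
    have hopen : IsOpen {z | 1 < ‖g z‖} := isOpen_lt continuous_const g.continuous.norm
    refine closure_mono ?_ (denseRange_stoneCechUnit.open_subset_closure_inter hopen hg)
    rintro _ ⟨hz, x, rfl⟩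
    exact ⟨x, hz, rfl⟩

end StoneCech

theorem stmt_12 {X : Type u} [TopologicalSpace X] [T35Space X]
    (H : Ideal (X →ᵇ ℂ)) (hclosed : IsClosed (H : Set (X →ᵇ ℂ)))
    (hnv : ∀ x : X, ∃ h ∈ H, h x ≠ 0) :
    (∀ y : ↥(lambdaH (H : Set (X →ᵇ ℂ))), IsOpen (connectedComponent y)) ↔
      ∃ (ι : Type u) (Hi : ι → Ideal (X →ᵇ ℂ)),
        (∀ i, IsClosed ((Hi i : Set (X →ᵇ ℂ))) ∧ Indecomposable' (Hi i)) ∧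
        (∀ i : ι, Hi i ⊓ (⨆ j ∈ {j : ι | j ≠ i}, Hi j) = ⊥) ∧
        (H : Set (X →ᵇ ℂ)) = closure ((⨆ i, Hi i : Ideal (X →ᵇ ℂ)) : Set (X →ᵇ ℂ)) := by
  change _ ↔ Ideal.HasIndecomposableDecomposition.{u} H
  have hcomap : IsClosed (StoneCech.restrictEquiv.idealComapOrderIso H : Set C(StoneCech X, ℂ)) :=
    hclosed.preimage StoneCech.isHomeomorph_restrictEquiv.continuous
  rw [StoneCech.lambdaH_eq_setOfIdeal,
    (ContinuousMap.setOfIdeal_open _).isOpen_connectedComponent_iff_exists_partition,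
    ← ContinuousMap.hasIndecomposableDecomposition_iff hcomap]
  refine ⟨fun h => ?_, fun h =>
    h.idealComapOrderIso _ StoneCech.isHomeomorph_restrictEquiv⟩
  have h' := h.idealComapOrderIso _ StoneCech.isHomeomorph_restrictEquiv_symm
  convert h'
  ext f
  change f ∈ H ↔ StoneCech.restrictEquiv (StoneCech.restrictEquiv.symm f) ∈ H
  rw [RingEquiv.apply_symm_apply]
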